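/- Let M=(S,P,I,AP,L) be a finite possibilistic Kripke structure and s∈S. Define M₁=(S₁,P₁,I₁,AP,L₁) by: S₁ is the least subset of S×ℕ containing (s,0) such that (u,n)∈S₁ and P(u,t)>0 imply (t,n+1)∈S₁; P₁((u,n),(t,m))=P(u,t) if m=n+1 and 0 otherwise; L₁(u,n)=L(u); and (s,0) is the unique initial state. Then M₁ is a possibilistic Kripke structure, and for every (u,n)∈S₁ and every PoCTL state formula Φ, M,u⊨Φ if and only if M₁,(u,n)⊨Φ. -/

import Mathlib

open Set

/-- An interval `J ⊆ [0,1]` with rational bounds. -/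
inductive RatInterval : Type where
  | icc (u v : ℚ)
  | ioc (u v : ℚ)
  | ico (u v : ℚ)
  | ioo (u v : ℚ)
  deriving DecidableEq

/-- Membership of a real number in a rational-bounded interval. -/
def RatInterval.mem : RatInterval → ℝ → Prop
  | .icc u v, x => (u : ℝ) ≤ x ∧ x ≤ (v : ℝ)
  | .ioc u v, x => (u : ℝ) < x ∧ x ≤ (v : ℝ)
  | .ico u v, x => (u : ℝ) ≤ x ∧ x < (v : ℝ)
  | .ioo u v, x => (u : ℝ) < x ∧ x < (v : ℝ)

mutual
/-- PoCTL state formulae (including the derived connective `∨`, the necessity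
operator `Ne_J`, and in path formulae the operators `𝐑`, `◇`). -/
inductive SF (A : Type) : Type where
  | tt : SF A
  | atom : A → SF A
  | and : SF A → SF A → SF A
  | or : SF A → SF A → SF A
  | not : SF A → SF A
  | po : RatInterval → PF A → SF A
  | ne : RatInterval → PF A → SF A

/-- PoCTL path formulae. -/
inductive PF (A : Type) : Type where
  | next : SF A → PF A
  | untl : SF A → SF A → PF A
  | buntl : ℕ → SF A → SF A → PF A
  | rel : SF A → SF A → PF A
  | ev : SF A → PF A
  | box : SF A → PF A
end

/-- `Po_{≥r}(φ)`. -/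
def poGe {A : Type} (r : ℚ) (φ : PF A) : SF A := .po (.icc r 1) φ
/-- `Po_{>r}(φ)`. -/
def poGt {A : Type} (r : ℚ) (φ : PF A) : SF A := .po (.ioc r 1) φ
/-- `Po_{≤r}(φ)`. -/
def poLe {A : Type} (r : ℚ) (φ : PF A) : SF A := .po (.icc 0 r) φ
/-- `Po_{<r}(φ)`. -/
def poLt {A : Type} (r : ℚ) (φ : PF A) : SF A := .po (.ico 0 r) φ
/-- `Ne_{≥r}(φ)`. -/
def neGe {A : Type} (r : ℚ) (φ : PF A) : SF A := .ne (.icc r 1) φ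
/-- `Ne_{>r}(φ)`. -/
def neGt {A : Type} (r : ℚ) (φ : PF A) : SF A := .ne (.ioc r 1) φ
/-- `Ne_{≤r}(φ)`. -/
def neLe {A : Type} (r : ℚ) (φ : PF A) : SF A := .ne (.icc 0 r) φ
/-- `Ne_{<r}(φ)`. -/
def neLt {A : Type} (r : ℚ) (φ : PF A) : SF A := .ne (.ico 0 r) φ
/-- A possibilistic Kripke structure over states `S` and atomic propositions `A`. -/
structure PKS (S A : Type) where
  P : S → S → ℝ
  init : S → ℝ
  L : S → Set A
  countable : Countable S
  nonempty : Nonempty S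
  P_nonneg : ∀ s t, 0 ≤ P s t
  P_le_one : ∀ s t, P s t ≤ 1
  P_sup : ∀ s, (⨆ t, P s t) = 1
  init_nonneg : ∀ s, 0 ≤ init s
  init_le_one : ∀ s, init s ≤ 1
  init_sup : (⨆ s, init s) = 1

variable {S A : Type}

/-- `π` is a path of `M`: all transition possibilities along `π` are positive. -/
def PKS.IsPath (M : PKS S A) (π : ℕ → S) : Prop := ∀ i, 0 < M.P (π i) (π (i + 1))

/-- The set of all paths of `M`. -/
def PKS.Paths (M : PKS S A) : Set (ℕ → S) := {π | M.IsPath π}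

/-- `Po^{M_s}(π) = inf { P(sᵢ,sᵢ₊₁) : i ≥ 0 }`, the possibility of a path in the
structure with unique initial state `π 0`. -/
noncomputable def PKS.poPathFrom (M : PKS S A) (π : ℕ → S) : ℝ :=
  ⨅ i, M.P (π i) (π (i + 1))

mutual
/-- Satisfaction of PoCTL state formulae at a state of a PKS. -/
def SF.Sat (M : PKS S A) (s : S) : SF A → Prop
  | .tt => True
  | .atom a => a ∈ M.L s
  | .and Φ Ψ => SF.Sat M s Φ ∧ SF.Sat M s Ψ
  | .or Φ Ψ => SF.Sat M s Φ ∨ SF.Sat M s Ψ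
  | .not Φ => ¬ SF.Sat M s Φ
  | .po J φ => J.mem (sSup {x : ℝ | ∃ π : ℕ → S,
      M.IsPath π ∧ π 0 = s ∧ PF.Sat M π φ ∧ x = M.poPathFrom π})
  | .ne J φ => J.mem (1 - sSup {x : ℝ | ∃ π : ℕ → S,
      M.IsPath π ∧ π 0 = s ∧ ¬ PF.Sat M π φ ∧ x = M.poPathFrom π})

/-- Satisfaction of PoCTL path formulae along a path of a PKS. -/
def PF.Sat (M : PKS S A) (π : ℕ → S) : PF A → Prop
  | .next Φ => SF.Sat M (π 1) Φ
  | .untl Φ Ψ => ∃ k, SF.Sat M (π k) Ψ ∧ ∀ i < k, SF.Sat M (π i) Φ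
  | .buntl n Φ Ψ => ∃ k ≤ n, SF.Sat M (π k) Ψ ∧ ∀ i < k, SF.Sat M (π i) Φ
  | .rel Φ Ψ => ∀ j, ¬ SF.Sat M (π j) Ψ → ∃ k < j, SF.Sat M (π k) Φ
  | .ev Φ => ∃ j, SF.Sat M (π j) Φ
  | .box Φ => ∀ j, SF.Sat M (π j) Φ
end

/-- Equivalence of PoCTL state formulae: same truth value at every state of every PKS. -/
def SFEquiv {A : Type} (Φ Ψ : SF A) : Prop :=
  ∀ (S : Type) (M : PKS S A) (s : S), SF.Sat M s Φ ↔ SF.Sat M s Ψ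
/-- The least subset of `S × ℕ` containing `(s,0)` and closed under
`(u,n) ∈ S₁ ∧ P(u,t) > 0 → (t,n+1) ∈ S₁`: the state set of the unwinding of `M` at `s`. -/
inductive Unwind {S A : Type} (M : PKS S A) (s : S) : S × ℕ → Prop
  | base : Unwind M s (s, 0)
  | step {u : S} {n : ℕ} {t : S} : Unwind M s (u, n) → 0 < M.P u t → Unwind M s (t, n + 1)

/-- A functional bisimulation: a label-preserving map along which positive transitions are
preserved, with their possibilities, and can be lifted. -/
structure PKS.IsBisim {T S A : Type} (N : PKS T A) (M : PKS S A) (f : T → S) : Prop where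
  label : ∀ p, N.L p = M.L (f p)
  forth : ∀ p q, 0 < N.P p q → M.P (f p) (f q) = N.P p q
  back : ∀ p t, 0 < M.P (f p) t → ∃ q, f q = t ∧ N.P p q = M.P (f p) t

namespace PKS.IsBisim

variable {T : Type} {N : PKS T A} {M : PKS S A} {f : T → S}

theorem isPath_comp (h : N.IsBisim M f) {π : ℕ → T} (hπ : N.IsPath π) : M.IsPath (f ∘ π) :=
  fun i => (hπ i).trans_eq (h.forth _ _ (hπ i)).symm

theorem poPathFrom_comp (h : N.IsBisim M f) {π : ℕ → T} (hπ : N.IsPath π) :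
    M.poPathFrom (f ∘ π) = N.poPathFrom π :=
  iInf_congr fun i => h.forth _ _ (hπ i)

theorem exists_lift (h : N.IsBisim M f) (p : T) {π : ℕ → S} (hπ : M.IsPath π)
    (h0 : π 0 = f p) : ∃ ρ : ℕ → T, N.IsPath ρ ∧ ρ 0 = p ∧ f ∘ ρ = π := by
  choose! g hg using h.back
  let ρ : ℕ → T := fun n => Nat.rec p (fun i q => g q (π (i + 1))) n
  have key : ∀ n, f (ρ n) = π n := by
    intro n
    induction n with
    | zero => exact h0.symm
    | succ n ih => exact (hg (ρ n) (π (n + 1)) (by rw [ih]; exact hπ n)).1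
  refine ⟨ρ, fun n => ?_, rfl, funext key⟩
  have hpos : 0 < M.P (f (ρ n)) (π (n + 1)) := by rw [key]; exact hπ n
  exact hpos.trans_eq (hg _ _ hpos).2.symm

theorem possibilities_eq (h : N.IsBisim M f) (p : T) {E : (ℕ → S) → Prop}
    {F : (ℕ → T) → Prop} (hEF : ∀ ρ, E (f ∘ ρ) ↔ F ρ) :
    {x : ℝ | ∃ π : ℕ → S, M.IsPath π ∧ π 0 = f p ∧ E π ∧ x = M.poPathFrom π} =
      {x : ℝ | ∃ ρ : ℕ → T, N.IsPath ρ ∧ ρ 0 = p ∧ F ρ ∧ x = N.poPathFrom ρ} := by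
  ext x
  constructor
  · rintro ⟨π, hπ, h0, hE, rfl⟩
    obtain ⟨ρ, hρ, hρ0, rfl⟩ := h.exists_lift p hπ h0
    exact ⟨ρ, hρ, hρ0, (hEF ρ).1 hE, h.poPathFrom_comp hρ⟩
  · rintro ⟨ρ, hρ, rfl, hF, rfl⟩
    exact ⟨f ∘ ρ, h.isPath_comp hρ, rfl, (hEF ρ).2 hF, (h.poPathFrom_comp hρ).symm⟩

mutual

theorem sat_iff (h : N.IsBisim M f) (p : T) :
    ∀ Φ : SF A, SF.Sat M (f p) Φ ↔ SF.Sat N p Φ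
  | .tt => by simp only [SF.Sat]
  | .atom a => by simp only [SF.Sat, h.label]
  | .and Φ Ψ => by simp only [SF.Sat, sat_iff h p Φ, sat_iff h p Ψ]
  | .or Φ Ψ => by simp only [SF.Sat, sat_iff h p Φ, sat_iff h p Ψ]
  | .not Φ => by simp only [SF.Sat, sat_iff h p Φ]
  | .po J φ => by
    simp only [SF.Sat]
    rw [h.possibilities_eq p fun ρ => path_sat_iff h ρ φ]
  | .ne J φ => by
    simp only [SF.Sat]
    rw [h.possibilities_eq p fun ρ => not_congr (path_sat_iff h ρ φ)]

theorem path_sat_iff (h : N.IsBisim M f) (ρ : ℕ → T) :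
    ∀ φ : PF A, PF.Sat M (f ∘ ρ) φ ↔ PF.Sat N ρ φ
  | .next Φ => by simp only [PF.Sat, Function.comp_apply, fun p => sat_iff h p Φ]
  | .untl Φ Ψ => by
    simp only [PF.Sat, Function.comp_apply, fun p => sat_iff h p Φ, fun p => sat_iff h p Ψ]
  | .buntl _ Φ Ψ => by
    simp only [PF.Sat, Function.comp_apply, fun p => sat_iff h p Φ, fun p => sat_iff h p Ψ]
  | .rel Φ Ψ => by
    simp only [PF.Sat, Function.comp_apply, fun p => sat_iff h p Φ, fun p => sat_iff h p Ψ]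
  | .ev Φ => by simp only [PF.Sat, Function.comp_apply, fun p => sat_iff h p Φ]
  | .box Φ => by simp only [PF.Sat, Function.comp_apply, fun p => sat_iff h p Φ]

end

end PKS.IsBisim

theorem ciSup_eq_of_forall_le_of_apply_eq {ι : Type*} {g : ι → ℝ} {b : ℝ} (hle : ∀ i, g i ≤ b)
    {i : ι} (hi : g i = b) : (⨆ j, g j) = b :=
  have : Nonempty ι := ⟨i⟩
  le_antisymm (ciSup_le hle) (hi ▸ le_ciSup ⟨b, forall_mem_range.2 hle⟩ i)

theorem PKS.exists_P_eq_one [Finite S] (M : PKS S A) (u : S) : ∃ t, M.P u t = 1 := by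
  have := M.nonempty
  obtain ⟨t, ht⟩ := exists_eq_ciSup_of_finite (f := M.P u)
  exact ⟨t, ht.trans (M.P_sup u)⟩

/-- The unwinding of a finite possibilistic Kripke structure `M` at the state `s`. -/
noncomputable def PKS.unwinding [Finite S] [DecidableEq S] (M : PKS S A) (s : S) :
    PKS {p : S × ℕ // Unwind M s p} A where
  P p q := if q.1.2 = p.1.2 + 1 then M.P p.1.1 q.1.1 else 0
  init p := if p.1 = (s, 0) then 1 else 0
  L p := M.L p.1.1
  countable := by
    have := M.countable
    infer_instance
  nonempty := ⟨⟨(s, 0), .base⟩⟩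
  P_nonneg p q := by
    split_ifs
    exacts [M.P_nonneg _ _, le_rfl]
  P_le_one p q := by
    split_ifs
    exacts [M.P_le_one _ _, zero_le_one]
  P_sup p := by
    obtain ⟨t, ht⟩ := M.exists_P_eq_one p.1.1
    refine ciSup_eq_of_forall_le_of_apply_eq (fun q => ?_)
      (i := ⟨(t, p.1.2 + 1), .step p.2 (ht ▸ zero_lt_one)⟩) ((if_pos rfl).trans ht)
    split_ifs
    exacts [M.P_le_one _ _, zero_le_one]
  init_nonneg p := by
    split_ifs
    exacts [zero_le_one, le_rfl]
  init_le_one p := by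
    split_ifs
    exacts [le_rfl, zero_le_one]
  init_sup := by
    refine ciSup_eq_of_forall_le_of_apply_eq (fun p => ?_) (i := ⟨(s, 0), .base⟩) (if_pos rfl)
    split_ifs
    exacts [le_rfl, zero_le_one]

theorem PKS.isBisim_unwinding [Finite S] [DecidableEq S] (M : PKS S A) (s : S) :
    (M.unwinding s).IsBisim M fun p => p.1.1 where
  label _ := rfl
  forth p q h := by
    by_cases hq : q.1.2 = p.1.2 + 1
    · exact (if_pos hq).symm
    · exact absurd h (by simp [PKS.unwinding, hq])
  back p t h := ⟨⟨(t, p.1.2 + 1), .step p.2 h⟩, rfl, if_pos rfl⟩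

/-- **Proposition.** Let `M` be a finite PKS and `s` a state. The unwinding `M₁` of `M` at
`s` — with state set `S₁` the least subset of `S × ℕ` as above,
`P₁((u,n),(t,m)) = P(u,t)` if `m = n+1` and `0` otherwise, `L₁(u,n) = L(u)`, and unique
initial state `(s,0)` — is a possibilistic Kripke structure, and for every `(u,n) ∈ S₁`
and every PoCTL state formula `Φ`, `M,u ⊨ Φ` iff `M₁,(u,n) ⊨ Φ`. -/
theorem unwinding_preserves_sat {S A : Type} [Finite S] [DecidableEq S] (M : PKS S A) (s : S) :
    ∃ M₁ : PKS {p : S × ℕ // Unwind M s p} A,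
      (∀ p q : {p : S × ℕ // Unwind M s p},
          M₁.P p q = if q.1.2 = p.1.2 + 1 then M.P p.1.1 q.1.1 else 0) ∧
      (∀ p : {p : S × ℕ // Unwind M s p}, M₁.init p = if p.1 = (s, 0) then 1 else 0) ∧
      (∀ p : {p : S × ℕ // Unwind M s p}, M₁.L p = M.L p.1.1) ∧
      ∀ (p : {p : S × ℕ // Unwind M s p}) (Φ : SF A),
        SF.Sat M p.1.1 Φ ↔ SF.Sat M₁ p Φ := by
  exact ⟨M.unwinding s, fun _ _ => rfl, fun _ => rfl, fun _ => rfl,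
    (M.isBisim_unwinding s).sat_iff⟩
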